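/- arXiv:2107.11780 — 3 statements merged into one kernel-verified Lean document; each statement's English description precedes it below -/
import Mathlib

section
/- Let k ≥ 1 be an integer and let G be a finite graph with no stable (independent) set of size k. Then the number of vertices of G is at most ω(G)^{k-1} + ω(G)^{k-2} + ... + ω(G), where ω(G) denotes the clique number of G. -/
open SimpleGraph

open Classical in
/-- A vertex set containing no stable set of size `k + 1` has at most `w + w ^ 2 + ⋯ + w ^ k`
vertices, where `w` bounds the size of every clique. -/
theorem card_le_sum_pow_of_forall_not_isClique_compl {V : Type*} (G : SimpleGraph V) (w : ℕ)
    (hw : ∀ s : Finset V, G.IsClique (s : Set V) → s.card ≤ w) (k : ℕ) (A : Finset V)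
    (hA : ∀ s ⊆ A, Gᶜ.IsClique (s : Set V) → s.card ≠ k + 1) :
    A.card ≤ ∑ i ∈ Finset.Ico 1 (k + 1), w ^ i := by
  induction k generalizing A with
  | zero =>
    have hempty : A = ∅ := by
      refine Finset.eq_empty_of_forall_notMem fun a ha => ?_
      exact hA {a} (by simpa using ha) (by simp) (by simp)
    simp [hempty]
  | succ k ih =>
    obtain ⟨C, hC, hmax⟩ := Finset.exists_max_image
      (A.powerset.filter fun s : Finset V => G.IsClique (s : Set V)) Finset.card ⟨∅, by simp⟩
    simp only [Finset.mem_filter, Finset.mem_powerset] at hC hmax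
    let N : V → Finset V := fun c => A.filter fun x => Gᶜ.Adj c x
    have hcover : A ⊆ C ∪ C.biUnion N := by
      intro x hx
      by_contra hxC
      simp only [N, Finset.mem_union, Finset.mem_biUnion, Finset.mem_filter, not_or, not_exists,
        not_and, compl_adj, not_not] at hxC
      have hclique : G.IsClique (insert x C : Finset V) := by
        rw [Finset.coe_insert, isClique_insert]
        exact ⟨hC.2, fun c hc hne => (hxC.2 c hc hx hne.symm).symm⟩
      have hcard := hmax _ ⟨Finset.insert_subset hx hC.1, hclique⟩
      rw [Finset.card_insert_of_notMem hxC.1] at hcard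
      omega
    have hN : ∀ c ∈ C, (N c).card ≤ ∑ i ∈ Finset.Ico 1 (k + 1), w ^ i := by
      intro c hc
      refine ih _ fun s hs hstable hcard => ?_
      have hcs : c ∉ s := fun h => Gᶜ.irrefl (Finset.mem_filter.1 (hs h)).2
      refine hA (insert c s) (Finset.insert_subset (hC.1 hc)
        (hs.trans (Finset.filter_subset _ _))) ?_ ?_
      · rw [Finset.coe_insert, isClique_insert]
        exact ⟨hstable, fun x hx _ => (Finset.mem_filter.1 (hs hx)).2⟩
      · rw [Finset.card_insert_of_notMem hcs, hcard]
    calc A.card ≤ C.card + (C.biUnion N).card :=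
          (Finset.card_le_card hcover).trans (Finset.card_union_le _ _)
      _ ≤ w + w * ∑ i ∈ Finset.Ico 1 (k + 1), w ^ i :=
          add_le_add (hw C hC.2) ((Finset.card_biUnion_le_card_mul _ _ _ hN).trans
            (Nat.mul_le_mul_right _ (hw C hC.2)))
      _ = ∑ i ∈ Finset.Ico 1 (k + 1 + 1), w ^ i := by
          rw [Finset.sum_eq_sum_Ico_succ_bot (by omega : 1 < k + 1 + 1),
            ← Finset.sum_Ico_add' (fun i => w ^ i) 1 (k + 1) 1, Finset.mul_sum]
          simp only [pow_succ', pow_zero, mul_one]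

theorem stmt_0 {V : Type*} [Fintype V] (G : SimpleGraph V) (k : ℕ) (hk : 1 ≤ k)
    (hstab : ¬ ∃ s : Finset V, s.card = k ∧ Gᶜ.IsClique (s : Set V)) :
    Fintype.card V ≤ ∑ i ∈ Finset.Ico 1 k, G.cliqueNum ^ i := by
  obtain ⟨k, rfl⟩ := Nat.exists_eq_add_of_le' hk
  exact card_le_sum_pow_of_forall_not_isClique_compl G G.cliqueNum
    (fun s hs => IsClique.card_le_cliqueNum (tc := hs)) k Finset.univ
    fun s _ hs hcard => hstab ⟨s, hcard, hs⟩
end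

section
/- Let H' be a graph such that there exists a natural number c' with χ(G) ≤ ω(G)^{c'} for every nonempty finite H'-free graph G. Let k ≥ 1, let S be the star K_{1,k} on k+1 vertices, and let H be the disjoint union of H' and S. Then there exists a natural number c such that χ(G) ≤ ω(G)^{c} for every nonempty finite H-free graph G. -/
open SimpleGraph

/-- `G` has no induced subgraph isomorphic to `H`. -/
def IsInducedSubgraphFree {W V : Type*} (H : SimpleGraph W) (G : SimpleGraph V) : Prop :=
  ¬ ∃ s : Set V, Nonempty (H ≃g G.induce s)

namespace SimpleGraph

variable {V : Type*} {G : SimpleGraph V}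

/-- The vertices in `s` can be properly coloured with `m` colours. -/
def ColorableOn (G : SimpleGraph V) (s : Finset V) (m : ℕ) : Prop :=
  ∃ f : V → ℕ, (∀ v ∈ s, f v < m) ∧ ∀ u ∈ s, ∀ v ∈ s, G.Adj u v → f u ≠ f v

theorem ColorableOn.mono {s t : Finset V} {m n : ℕ} (h : G.ColorableOn t m) (hst : s ⊆ t)
    (hmn : m ≤ n) : G.ColorableOn s n := by
  obtain ⟨f, hf, hadj⟩ := h
  exact ⟨f, fun v hv => (hf v (hst hv)).trans_le hmn,
    fun u hu v hv => hadj u (hst hu) v (hst hv)⟩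

theorem ColorableOn.empty (m : ℕ) : G.ColorableOn ∅ m :=
  ⟨fun _ => 0, by simp, by simp⟩

theorem ColorableOn.union [DecidableEq V] {s t : Finset V} {m n : ℕ} (hs : G.ColorableOn s m)
    (ht : G.ColorableOn t n) : G.ColorableOn (s ∪ t) (m + n) := by
  obtain ⟨f, hf, hfadj⟩ := hs
  obtain ⟨g, hg, hgadj⟩ := ht
  refine ⟨fun v => if v ∈ s then f v else m + g v, fun v hv => ?_, fun u hu v hv huv => ?_⟩
  · rw [Finset.mem_union] at hv
    grind
  · rw [Finset.mem_union] at hu hv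
    grind

theorem ColorableOn.biUnion [DecidableEq V] {ι : Type*} {A : Finset ι} {t : ι → Finset V} {m : ℕ}
    (h : ∀ i ∈ A, G.ColorableOn (t i) m) : G.ColorableOn (A.biUnion t) (A.card * m) := by
  classical
  induction A using Finset.induction_on with
  | empty => simpa using ColorableOn.empty 0
  | insert a A ha ih =>
    rw [Finset.biUnion_insert, Finset.card_insert_of_notMem ha]
    exact ((h a (by simp)).union (ih fun i hi => h i (by simp [hi]))).mono subset_rfl
      (by rw [add_mul, one_mul, add_comm])

theorem ColorableOn.of_card_le {s : Finset V} {m : ℕ} (h : s.card ≤ m) : G.ColorableOn s m := by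
  classical
  have : G.ColorableOn (s.biUnion fun v => {v}) (s.card * 1) :=
    ColorableOn.biUnion fun v _ => ⟨fun _ => 0, by simp, by simp +contextual⟩
  exact this.mono (by simp) (by simpa using h)

/-- Greedy extension of a colouring to a vertex of small degree. -/
theorem ColorableOn.of_erase [DecidableEq V] {s : Finset V} {v : V} {m : ℕ}
    (h : G.ColorableOn (s.erase v) m) {t : Finset V} (ht : ∀ u ∈ s, G.Adj v u → u ∈ t)
    (hcard : t.card < m) : G.ColorableOn s m := by
  obtain ⟨f, hf, hadj⟩ := h
  obtain ⟨a, ha, hat⟩ : ∃ a ∈ Finset.range m, a ∉ t.image f :=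
    Finset.exists_mem_notMem_of_card_lt_card
      (Finset.card_image_le.trans_lt (by simpa using hcard))
  rw [Finset.mem_range] at ha
  have hne : ∀ u ∈ s, G.Adj v u → a ≠ f u := fun u hu huv h =>
    hat (Finset.mem_image.2 ⟨u, ht u hu huv, h.symm⟩)
  refine ⟨fun u => if u = v then a else f u, fun u hu => ?_, fun u hu w hw huw => ?_⟩
  · grind
  · have h1 := hne w hw
    have h2 := hne u hu
    have h3 := huw.symm
    have h4 := huw.ne
    grind

/-- A polynomial Ramsey bound for sets without a clique of size `n + 1`. -/
theorem CliqueFreeOn.exists_isIndepSet {n : ℕ} (hn : 1 ≤ n) (k : ℕ) {s : Finset V}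
    (hs : G.CliqueFreeOn s (n + 1)) (hcard : (2 * n) ^ k ≤ s.card) :
    ∃ I ⊆ s, I.card = k ∧ G.IsIndepSet (I : Set V) := by
  classical
  induction k generalizing s with
  | zero => exact ⟨∅, by simp, by simp, by simp⟩
  | succ k ih =>
    obtain ⟨K, hK, hmax⟩ := (s.powerset.filter fun K : Finset V => G.IsClique (K : Set V)).exists_maximal
      ⟨∅, by simp⟩
    rw [Finset.mem_filter, Finset.mem_powerset] at hK
    have hKn : K.card ≤ n := by
      by_contra! h
      obtain ⟨L, hL, hLc⟩ := Finset.exists_subset_card_eq (n := n + 1) h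
      exact hs (t := L) (by exact_mod_cast hL.trans hK.1) ⟨hK.2.subset (by exact_mod_cast hL), hLc⟩
    have hcover : s ⊆ K.biUnion fun x => s.filter fun y => ¬ G.Adj x y := by
      intro y hy
      simp only [Finset.mem_biUnion, Finset.mem_filter]
      by_contra! h
      have hyK : y ∈ K := by
        refine hmax (y := insert y K) ?_ (Finset.subset_insert _ _) (Finset.mem_insert_self _ _)
        refine Finset.mem_filter.2 ⟨Finset.mem_powerset.2 (Finset.insert_subset hy hK.1), ?_⟩
        rw [Finset.coe_insert]
        exact hK.2.insert fun b hb _ => (h b hb hy).symm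
      exact G.irrefl (h y hyK hy)
    obtain ⟨x, hx, hxc⟩ : ∃ x ∈ K, (2 * n) ^ k + 1 ≤ (s.filter fun y => ¬ G.Adj x y).card := by
      by_contra! h
      have h1 : s.card ≤ K.card * (2 * n) ^ k :=
        (Finset.card_le_card hcover).trans
          (Finset.card_biUnion_le_card_mul _ _ _ fun x hx => Nat.lt_succ_iff.1 (h x hx))
      have h2 : K.card * (2 * n) ^ k ≤ n * (2 * n) ^ k := Nat.mul_le_mul_right _ hKn
      have h3 : 0 < n * (2 * n) ^ k := by positivity
      rw [pow_succ] at hcard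
      nlinarith
    set t := (s.filter fun y => ¬ G.Adj x y).erase x with ht
    have hts : t ⊆ s := (Finset.erase_subset _ _).trans (Finset.filter_subset _ _)
    obtain ⟨I, hI, hIc, hIi⟩ := ih (s := t) (hs.subset _ (by exact_mod_cast hts))
      (by have := Finset.pred_card_le_card_erase (s := s.filter fun y => ¬ G.Adj x y) (a := x)
          rw [ht]
          omega)
    have hxI : x ∉ I := fun h => by simpa [ht] using hI h
    refine ⟨insert x I, Finset.insert_subset (hK.1 hx) (hI.trans hts), ?_, ?_⟩
    · rw [Finset.card_insert_of_notMem hxI, hIc]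
    · rw [Finset.coe_insert, ← isClique_compl]
      rw [← isClique_compl] at hIi
      refine hIi.insert fun b hb hxb => ⟨hxb, ?_⟩
      have := hI hb
      simp only [ht, Finset.mem_erase, Finset.mem_filter] at this
      exact this.2.2

/-- Either `s` contains many disjoint cliques of size `r`, or a small set meets all of them. -/
theorem exists_disjoint_cliques_or_cliqueFreeOn_sdiff [DecidableEq V] (G : SimpleGraph V)
    (s : Finset V) {r : ℕ} (hr : 1 ≤ r) (T : ℕ) :
    (∃ F : Finset (Finset V), F.card = T ∧ (∀ C ∈ F, C ⊆ s ∧ G.IsNClique r C) ∧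
      (F : Set (Finset V)).PairwiseDisjoint id) ∨
    ∃ U ⊆ s, U.card ≤ T * r ∧ G.CliqueFreeOn (s \ U : Finset V) r := by
  induction T with
  | zero => exact Or.inl ⟨∅, by simp, by simp, by simp⟩
  | succ T ih =>
    obtain ⟨F, hF, hFC, hFd⟩ | ⟨U, hUs, hU, hfree⟩ := ih
    · by_cases hfree : G.CliqueFreeOn (s \ F.biUnion id : Finset V) r
      · refine Or.inr ⟨F.biUnion id, Finset.biUnion_subset.2 fun C hC => (hFC C hC).1, ?_, hfree⟩
        refine (Finset.card_biUnion_le_card_mul _ _ r fun C hC => (hFC C hC).2.card_eq.le).trans ?_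
        exact Nat.mul_le_mul_right _ (by omega)
      · simp only [CliqueFreeOn, not_forall, not_not] at hfree
        obtain ⟨C, hCs, hC⟩ := hfree
        rw [Finset.coe_subset] at hCs
        have hdisj : ∀ D ∈ F, Disjoint C D := fun D hD =>
          (Finset.disjoint_of_subset_left hCs Finset.sdiff_disjoint).mono_right
            (Finset.subset_biUnion_of_mem id hD)
        have hCF : C ∉ F := fun h => by
          have := hdisj C h
          rw [disjoint_self, Finset.bot_eq_empty] at this
          have := hC.card_eq
          simp_all
        refine Or.inl ⟨insert C F, by rw [Finset.card_insert_of_notMem hCF, hF], ?_, ?_⟩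
        · intro D hD
          obtain rfl | hD := Finset.mem_insert.1 hD
          · exact ⟨hCs.trans Finset.sdiff_subset, hC⟩
          · exact hFC D hD
        · rw [Finset.coe_insert]
          exact hFd.insert fun D hD _ => hdisj D hD
    · exact Or.inr ⟨U, hUs, hU.trans (Nat.mul_le_mul_right _ (by omega)), hfree⟩

/-- If every vertex of a clique `K` misses few vertices of a large disjoint family of sets,
then `K` is complete to a member of that family. -/
theorem exists_forall_adj_of_card_lt [DecidableEq V] [DecidableRel G.Adj]
    {F : Finset (Finset V)} {K : Finset V} {d : ℕ}
    (hFd : (F : Set (Finset V)).PairwiseDisjoint id)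
    (hK : ∀ u ∈ K, ((F.biUnion id).filter fun w => ¬ G.Adj u w).card ≤ d)
    (hcard : K.card * d < F.card) : ∃ C ∈ F, ∀ u ∈ K, ∀ w ∈ C, G.Adj u w := by
  by_contra! h
  have : Nonempty V := by
    obtain ⟨C, hC⟩ : F.Nonempty := Finset.card_pos.1 (by omega)
    obtain ⟨u, -⟩ := h C hC
    exact ⟨u⟩
  choose! u hu w hw hadj using h
  have hinj : Set.InjOn w F := fun C hC D hD hCD => by
    by_contra hne
    exact Finset.disjoint_left.1 (hFd hC hD hne) (hw C hC) (by rw [hCD]; exact hw D hD)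
  have hsub : F.image w ⊆ K.biUnion fun u => (F.biUnion id).filter fun w => ¬ G.Adj u w := by
    intro x hx
    obtain ⟨C, hC, rfl⟩ := Finset.mem_image.1 hx
    simp only [Finset.mem_biUnion, Finset.mem_filter]
    exact ⟨u C, hu C hC, ⟨C, hC, hw C hC⟩, hadj C hC⟩
  have := Finset.card_le_card hsub
  rw [Finset.card_image_of_injOn hinj] at this
  exact absurd (this.trans (Finset.card_biUnion_le_card_mul _ _ d hK)) (by omega)

/-- For every induced star with `k` leaves, the subgraphs anticomplete to it have chromatic number
at most the `e`th power of their clique number. -/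
def StarAnticompleteBounded (G : SimpleGraph V) (k e : ℕ) : Prop :=
  ∀ (n : ℕ) (t : Finset V) (v : V) (I : Finset V), G.CliqueFreeOn t (n + 1) → I.card = k →
    (∀ u ∈ I, G.Adj v u) → G.IsIndepSet (I : Set V) →
    (∀ u ∈ t, u ≠ v ∧ ¬ G.Adj v u ∧ ∀ w ∈ I, ¬ G.Adj u w) → G.ColorableOn t (n ^ e)

/-- The vertices of `s` not adjacent to `v` and missing many vertices of `A ⊆ N(v)` have bounded
chromatic number. -/
theorem StarAnticompleteBounded.colorableOn_filter [DecidableEq V] [DecidableRel G.Adj] {k e n : ℕ}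
    (hG : G.StarAnticompleteBounded k e) (hn : 1 ≤ n) {s A : Finset V} {v : V}
    (hs : G.CliqueFreeOn s (n + 1)) (hAs : A ⊆ s) (hA : ∀ u ∈ A, G.Adj v u) :
    G.ColorableOn (s.filter fun u => u ≠ v ∧ ¬ G.Adj v u ∧
      (2 * n) ^ k ≤ (A.filter fun w => ¬ G.Adj u w).card) (A.card ^ k * n ^ e) := by
  classical
  have hcol : G.ColorableOn (((A.powersetCard k).filter fun I : Finset V => G.IsIndepSet (I : Set V)).biUnion
      fun I => s.filter fun u => u ≠ v ∧ ¬ G.Adj v u ∧ ∀ w ∈ I, ¬ G.Adj u w)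
      (((A.powersetCard k).filter fun I : Finset V => G.IsIndepSet (I : Set V)).card * n ^ e) := by
    refine ColorableOn.biUnion fun I hI => ?_
    rw [Finset.mem_filter, Finset.mem_powersetCard] at hI
    refine hG n _ v I (hs.subset _ (by exact_mod_cast Finset.filter_subset _ _)) hI.1.2
      (fun u hu => hA u (hI.1.1 hu)) hI.2 fun u hu => (Finset.mem_filter.1 hu).2
  refine hcol.mono (fun u hu => ?_) (Nat.mul_le_mul_right _ ?_)
  · rw [Finset.mem_filter] at hu
    obtain ⟨hus, huv, hadj, hcard⟩ := hu
    obtain ⟨I, hI, hIc, hIi⟩ := CliqueFreeOn.exists_isIndepSet hn k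
      (hs.subset _ (by exact_mod_cast (Finset.filter_subset _ _).trans hAs)) hcard
    refine Finset.mem_biUnion.2 ⟨I, ?_, ?_⟩
    · rw [Finset.mem_filter, Finset.mem_powersetCard]
      exact ⟨⟨hI.trans (Finset.filter_subset _ _), hIc⟩, hIi⟩
    · exact Finset.mem_filter.2 ⟨hus, huv, hadj, fun w hw => (Finset.mem_filter.1 (hI hw)).2⟩
  · refine (Finset.card_filter_le _ _).trans ?_
    rw [Finset.card_powersetCard]
    exact Nat.choose_le_pow _ _

/-- A vertex of large degree splits the clique number between its neighbours and its
nonneighbours, up to sets of bounded chromatic number. -/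
theorem StarAnticompleteBounded.exists_colorableOn_add {k e n T : ℕ}
    (hG : G.StarAnticompleteBounded k e) (hn : 1 ≤ n) {s : Finset V}
    (hs : G.CliqueFreeOn s (n + 1)) {f : ℕ → ℕ}
    (hf : ∀ m < n, ∀ t : Finset V, G.CliqueFreeOn t (m + 1) → G.ColorableOn t (f m))
    {v : V} (hv : v ∈ s) {N : Finset V} (hNs : N ⊆ s) (hN : ∀ u ∈ s, u ∈ N ↔ G.Adj v u)
    (hT : n * (2 * n) ^ k < T) (hdeg : T < N.card) :
    ∃ a b, 1 ≤ a ∧ 1 ≤ b ∧ a + b = n ∧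
      G.ColorableOn s (1 + (f a + T * n) + ((T * n) ^ k * n ^ e + f b)) := by
  classical
  have hNfree : G.CliqueFreeOn N n := fun C hC hCc => hs (t := insert v C)
    (by rw [Finset.coe_insert]
        exact Set.insert_subset hv (hC.trans (by exact_mod_cast hNs)))
    (hCc.insert fun b hb => (hN b (hNs (hC hb))).1 (hC hb))
  let P : ℕ → Prop := fun r => ∃ F : Finset (Finset V), F.card = T ∧
    (∀ C ∈ F, C ⊆ N ∧ G.IsNClique r C) ∧ (F : Set (Finset V)).PairwiseDisjoint id
  have hP1 : P 1 := by
    refine (G.exists_disjoint_cliques_or_cliqueFreeOn_sdiff N le_rfl T).resolve_right ?_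
    rintro ⟨U, hUN, hU, hfree⟩
    obtain ⟨x, hx, hxU⟩ := Finset.exists_mem_notMem_of_card_lt_card
      (show U.card < N.card by omega)
    exact hfree (t := {x}) (by simp [hx, hxU]) (by simp [isNClique_iff])
  have hPn : ¬ P n := by
    rintro ⟨F, hF, hFC, -⟩
    obtain ⟨C, hC⟩ : F.Nonempty := Finset.card_pos.1 (by omega)
    exact hNfree (by exact_mod_cast (hFC C hC).1) (hFC C hC).2
  obtain ⟨a, ha1, han, ⟨F, hF, hFC, hFd⟩, hnot⟩ : ∃ a, 1 ≤ a ∧ a < n ∧ P a ∧ ¬ P (a + 1) := by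
    by_contra! h
    have : ∀ r, 1 ≤ r → r ≤ n → P r := fun r hr => by
      induction r, hr using Nat.le_induction with
      | base => exact fun _ => hP1
      | succ r hr ih => exact fun hrn => h r hr hrn (ih (by omega))
    exact hPn (this n hn le_rfl)
  obtain ⟨U, hUN, hU, hUfree⟩ :=
    (G.exists_disjoint_cliques_or_cliqueFreeOn_sdiff N (by omega : 1 ≤ a + 1) T).resolve_left hnot
  have hNcol : G.ColorableOn N (f a + T * n) := by
    refine ((hf a han _ hUfree).union (ColorableOn.of_card_le (m := T * n) ?_)).mono
      (t := (N \ U) ∪ U) (by simp) le_rfl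
    exact hU.trans (Nat.mul_le_mul_left _ han)
  set A := F.biUnion id with hA
  have hAN : A ⊆ N := Finset.biUnion_subset.2 fun C hC => (hFC C hC).1
  have hAcard : A.card ≤ T * n := by
    refine (Finset.card_biUnion_le_card_mul _ _ a fun C hC => (hFC C hC).2.card_eq.le).trans ?_
    rw [hF]
    exact Nat.mul_le_mul_left _ han.le
  have hbad := hG.colorableOn_filter hn hs (hAN.trans hNs) (v := v)
    fun u hu => (hN u (hNs (hAN hu))).1 (hAN hu)
  set good := s.filter fun u => (A.filter fun w => ¬ G.Adj u w).card ≤ (2 * n) ^ k with hgood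
  have hgoodfree : G.CliqueFreeOn good (n - a + 1) := by
    intro K hK hKc
    rw [Finset.coe_subset] at hK
    obtain ⟨C, hC, hCK⟩ := exists_forall_adj_of_card_lt (G := G) (K := K) (d := (2 * n) ^ k) hFd
      (fun u hu => (Finset.mem_filter.1 (hK hu)).2) (by
        rw [hF, hKc.card_eq]
        exact (Nat.mul_le_mul_right _ (by omega)).trans_lt hT)
    have hdisj : Disjoint K C := Finset.disjoint_left.2 fun x hxK hxC => G.irrefl (hCK x hxK x hxC)
    refine hs (t := K ∪ C) ?_ ⟨?_, ?_⟩
    · exact_mod_cast Finset.union_subset (hK.trans (Finset.filter_subset _ _))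
        ((hFC C hC).1.trans hNs)
    · intro x hx y hy hxy
      simp only [Finset.coe_union, Set.mem_union, Finset.mem_coe] at hx hy
      rcases hx with hx | hx <;> rcases hy with hy | hy
      · exact hKc.isClique hx hy hxy
      · exact hCK x hx y hy
      · exact (hCK y hy x hx).symm
      · exact (hFC C hC).2.isClique hx hy hxy
    · rw [Finset.card_union_of_disjoint hdisj, hKc.card_eq, (hFC C hC).2.card_eq]
      omega
  refine ⟨a, n - a, ha1, by omega, by omega, ?_⟩
  have hvcol : G.ColorableOn {v} 1 := ColorableOn.of_card_le (by simp)
  refine ((hvcol.union hNcol).union (hbad.union (hf (n - a) (by omega) good hgoodfree))).mono ?_ ?_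
  · intro u hu
    have := hN u hu
    simp only [Finset.mem_union, Finset.mem_singleton, Finset.mem_filter, hgood, hu, true_and]
    by_cases huv : u = v
    · simp [huv]
    · by_cases huN : u ∈ N
      · simp [huN]
      · have hadj : ¬ G.Adj v u := fun h => huN (this.2 h)
        rcases le_total ((2 * n) ^ k) (A.filter fun w => ¬ G.Adj u w).card with h | h
        · exact Or.inr (Or.inl ⟨huv, hadj, h⟩)
        · exact Or.inr (Or.inr h)
  · gcongr

end SimpleGraph

theorem pow_add_pow_add_pow_le_pow {a b : ℕ} (ha : 1 ≤ a) (hb : 1 ≤ b) (c : ℕ) :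
    a ^ (c + 2) + b ^ (c + 2) + (a + b) ^ c ≤ (a + b) ^ (c + 2) := by
  have h1 : a ^ c ≤ (a + b) ^ c := Nat.pow_le_pow_left (by omega) c
  have h2 : b ^ c ≤ (a + b) ^ c := Nat.pow_le_pow_left (by omega) c
  rw [pow_add, pow_add, pow_add]
  have h3 : 1 ≤ a * b := Nat.mul_pos ha hb
  calc a ^ c * a ^ 2 + b ^ c * b ^ 2 + (a + b) ^ c
      ≤ (a + b) ^ c * a ^ 2 + (a + b) ^ c * b ^ 2 + (a + b) ^ c * (a * b) := by
        gcongr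
        exact Nat.le_mul_of_pos_right _ h3
    _ ≤ (a + b) ^ c * (a + b) ^ 2 := by
        rw [← mul_add, ← mul_add]
        exact Nat.mul_le_mul_left _ (by nlinarith)

theorem mul_two_mul_pow_le {n : ℕ} (hn : 2 ≤ n) (k : ℕ) :
    (2 * n) ^ (k + 1) * n ≤ n ^ (2 * k + 4) := by
  calc (2 * n) ^ (k + 1) * n ≤ (n ^ 2) ^ (k + 1) * n ^ 2 := by
        gcongr
        · nlinarith
        · nlinarith
    _ = n ^ (2 * k + 4) := by ring

namespace SimpleGraph

theorem StarAnticompleteBounded.colorableOn_pow {V : Type*} {G : SimpleGraph V} {k e : ℕ}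
    (hG : G.StarAnticompleteBounded k e) (n : ℕ) (s : Finset V) (hs : G.CliqueFreeOn s (n + 1)) :
    G.ColorableOn s (n ^ ((2 * k + 4) * (k + 1) + e + 4)) := by
  classical
  set M := (2 * k + 4) * (k + 1) + e with hM
  induction n using Nat.strong_induction_on generalizing s with
  | _ n ih =>
    rcases Nat.lt_or_ge n 2 with hn | hn
    · interval_cases n
      · obtain rfl : s = ∅ := Finset.eq_empty_of_forall_notMem fun v hv =>
          hs (t := {v}) (by simpa using hv) (by simp [isNClique_iff])
        exact ColorableOn.empty _
      · refine ⟨fun _ => 0, by simp, fun u hu v hv huv => ?_⟩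
        exact absurd huv ((cliqueFreeOn_two G).1 hs hu hv huv.ne)
    have hT1 : n * (2 * n) ^ k < (2 * n) ^ (k + 1) := by
      rw [pow_succ']
      have : 0 < (2 * n) ^ k := by positivity
      nlinarith
    have hT2 := mul_two_mul_pow_le hn k
    have hpos : 0 < n := by omega
    induction s using Finset.strongInduction with
    | H s ihs =>
    rcases s.eq_empty_or_nonempty with rfl | ⟨v, hv⟩
    · exact ColorableOn.empty _
    have hTM : (2 * n) ^ (k + 1) * n ≤ n ^ M :=
      hT2.trans (Nat.pow_le_pow_right hpos (by rw [hM]; nlinarith))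
    rcases Nat.lt_or_ge ((2 * n) ^ (k + 1)) (s.filter (G.Adj v)).card with hdeg | hdeg
    · obtain ⟨a, b, ha, hb, hab, hcol⟩ := hG.exists_colorableOn_add (by omega) hs ih hv
        (Finset.filter_subset (G.Adj v) s) (fun u hu => by simp [hu]) hT1 hdeg
      refine hcol.mono subset_rfl ?_
      have h1 : ((2 * n) ^ (k + 1) * n) ^ k * n ^ e ≤ n ^ M := by
        calc ((2 * n) ^ (k + 1) * n) ^ k * n ^ e ≤ (n ^ (2 * k + 4)) ^ k * n ^ e := by gcongr
          _ = n ^ ((2 * k + 4) * k + e) := by rw [← pow_mul, ← pow_add]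
          _ ≤ n ^ M := Nat.pow_le_pow_right hpos (by rw [hM]; nlinarith)
      have h2 := pow_add_pow_add_pow_le_pow ha hb (M + 2)
      have h3 : 4 * n ^ M ≤ n ^ (M + 2) := by
        rw [pow_add n M 2, mul_comm]
        exact Nat.mul_le_mul_left _ (by nlinarith)
      have h4 : 1 ≤ n ^ M := Nat.one_le_pow _ _ hpos
      rw [hab, show M + 2 + 2 = M + 4 from rfl] at h2
      omega
    · refine (ihs (s.erase v) (Finset.erase_ssubset hv)
        (hs.subset _ (by exact_mod_cast Finset.erase_subset _ _))).of_erase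
        (t := s.filter (G.Adj v)) (fun u hu h => by simp [hu, h]) (hdeg.trans_lt ?_)
      have : 0 < (2 * n) ^ (k + 1) := by positivity
      calc (2 * n) ^ (k + 1) < (2 * n) ^ (k + 1) * n := by nlinarith
        _ ≤ n ^ M := hTM
        _ ≤ n ^ (M + 4) := Nat.pow_le_pow_right hpos (by omega)

theorem Colorable.colorableOn {V : Type*} {G : SimpleGraph V} {s : Finset V} {m : ℕ}
    (h : (G.induce (s : Set V)).Colorable m) : G.ColorableOn s m := by
  classical
  obtain ⟨C⟩ := h
  refine ⟨fun v => if hv : v ∈ s then C ⟨v, hv⟩ else 0, fun v hv => ?_, fun u hu v hv huv => ?_⟩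
  · simp [hv]
  · simp only [hu, hv, dif_pos]
    exact fun heq => C.valid (v := ⟨u, hu⟩) (w := ⟨v, hv⟩) huv (Fin.ext heq)

end SimpleGraph

theorem isInducedSubgraphFree_iff {W V : Type*} {H : SimpleGraph W} {G : SimpleGraph V} :
    IsInducedSubgraphFree H G ↔ IsEmpty (H ↪g G) := by
  rw [IsInducedSubgraphFree, ← not_nonempty_iff, not_iff_not]
  constructor
  · rintro ⟨s, ⟨e⟩⟩
    exact ⟨e.toEmbedding.trans (Embedding.induce s)⟩
  · rintro ⟨e⟩
    exact ⟨Set.range e, ⟨⟨Equiv.ofInjective e e.injective, by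
      intro a b
      exact e.map_adj_iff⟩⟩⟩

/-- An induced star, given by its centre `v` and its set `I` of leaves. -/
theorem exists_starEmbedding {V : Type*} {G : SimpleGraph V} {k : ℕ} {v : V} {I : Finset V}
    (hI : I.card = k) (hadj : ∀ u ∈ I, G.Adj v u) (hind : G.IsIndepSet (I : Set V)) :
    ∃ g : completeBipartiteGraph (Fin 1) (Fin k) ↪g G, ∀ x, g x = v ∨ g x ∈ I := by
  let e : Fin k ≃ I := (I.equivFinOfCardEq hI).symm
  have hind' : ∀ i j, ¬ G.Adj (e i : V) (e j) := fun i j h =>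
    hind (e i).2 (e j).2 h.ne h
  refine ⟨⟨⟨Sum.elim (fun _ => v) (fun i => e i), ?_⟩, ?_⟩, ?_⟩
  · rintro (i | i) (j | j) h
    · rw [Subsingleton.elim i j]
    · exact absurd h (hadj _ (e j).2).ne
    · exact absurd h.symm (hadj _ (e i).2).ne
    · exact congrArg _ (e.injective (Subtype.ext h))
  · rintro (i | i) (j | j)
    · change G.Adj v v ↔ _
      simp
    · change G.Adj v (e j) ↔ _
      simpa using hadj _ (e j).2
    · change G.Adj (e i) v ↔ _
      simpa using (hadj _ (e i).2).symm
    · change G.Adj (e i) (e j) ↔ _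
      simpa using hind' i j
  · rintro (i | i)
    · exact Or.inl rfl
    · exact Or.inr (e i).2

/-- An embedding of a disjoint union from embeddings with anticomplete images. -/
theorem nonempty_sum_embedding {W W' V : Type*} {H : SimpleGraph W} {H' : SimpleGraph W'}
    {G : SimpleGraph V} (f : H ↪g G) (g : H' ↪g G)
    (hfg : ∀ x y, f x ≠ g y ∧ ¬ G.Adj (f x) (g y)) : Nonempty (H ⊕g H' ↪g G) := by
  refine ⟨⟨⟨Sum.elim f g, f.injective.sumElim g.injective fun x y => (hfg x y).1⟩, ?_⟩⟩
  rintro (x | x) (y | y)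
  · exact f.map_adj_iff
  · change G.Adj (f x) (g y) ↔ _
    simpa using (hfg x y).2
  · change G.Adj (g x) (f y) ↔ _
    simpa [G.adj_comm] using (hfg y x).2
  · exact g.map_adj_iff

theorem starAnticompleteBounded_of_isInducedSubgraphFree {V' : Type} {H' : SimpleGraph V'} {e : ℕ}
    (hH' : ∀ (V : Type) [Fintype V] (G : SimpleGraph V), Nonempty V →
      IsInducedSubgraphFree H' G → G.chromaticNumber ≤ (G.cliqueNum ^ e : ℕ))
    {k : ℕ} {V : Type} {G : SimpleGraph V}
    (hG : IsInducedSubgraphFree (H' ⊕g completeBipartiteGraph (Fin 1) (Fin k)) G) :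
    G.StarAnticompleteBounded k e := by
  intro n t v I hfree hI hadj hind hanti
  rcases t.eq_empty_or_nonempty with rfl | hne
  · exact ColorableOn.empty _
  obtain ⟨g, hg⟩ := exists_starEmbedding hI hadj hind
  rw [isInducedSubgraphFree_iff] at hG
  have hH'free : IsInducedSubgraphFree H' (G.induce (t : Set V)) := by
    rw [isInducedSubgraphFree_iff]
    refine ⟨fun f => ?_⟩
    refine hG.elim (nonempty_sum_embedding (f.trans (Embedding.induce _)) g fun x y => ?_).some
    obtain ⟨h1, h2, h3⟩ := hanti (f x) (f x).2
    change (f x : V) ≠ g y ∧ ¬ G.Adj (f x : V) (g y)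
    rcases hg y with h | h
    · rw [h, G.adj_comm]
      exact ⟨h1, h2⟩
    · exact ⟨fun heq => h2 (heq ▸ hadj _ h), h3 _ h⟩
  have hcol := chromaticNumber_le_iff_colorable.1
    (hH' _ (G.induce (t : Set V)) hne.to_subtype hH'free)
  have hle : (G.induce (t : Set V)).cliqueNum ≤ n := by
    by_contra! h
    obtain ⟨K, hK⟩ := (G.induce (t : Set V)).exists_isNClique_cliqueNum
    exact ((G.cliqueFree_induce_iff _ _).2 hfree).mono h K hK
  exact (Colorable.mono (Nat.pow_le_pow_left hle e) hcol).colorableOn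

theorem stmt_2 {V' : Type} [Fintype V'] (H' : SimpleGraph V') (c' : ℕ)
    (hH' : ∀ (V : Type) [Fintype V] (G : SimpleGraph V), Nonempty V →
      IsInducedSubgraphFree H' G → G.chromaticNumber ≤ (G.cliqueNum ^ c' : ℕ))
    (k : ℕ) (hk : 1 ≤ k) :
    ∃ c : ℕ, ∀ (V : Type) [Fintype V] (G : SimpleGraph V), Nonempty V →
      IsInducedSubgraphFree (H' ⊕g completeBipartiteGraph (Fin 1) (Fin k)) G →
      G.chromaticNumber ≤ (G.cliqueNum ^ c : ℕ) := by
  refine ⟨(2 * k + 4) * (k + 1) + c' + 4, fun V _ G _ hG => ?_⟩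
  obtain ⟨f, hf, hadj⟩ := (starAnticompleteBounded_of_isInducedSubgraphFree hH' hG).colorableOn_pow
    G.cliqueNum Finset.univ fun K _ hK => by
      have := hK.isClique.card_le_cliqueNum
      rw [hK.card_eq] at this
      omega
  refine chromaticNumber_le_iff_colorable.2 ⟨Coloring.mk (fun v => ⟨f v, hf v (by simp)⟩) ?_⟩
  exact fun {u v} huv heq => hadj u (by simp) v (by simp) huv (congrArg Fin.val heq)
end

section
/- Let H' be a graph such that there exists a polynomial f' with χ(G) ≤ f'(ω(G)) for every finite H'-free graph G. Let k ≥ 1, let S be the star K_{1,k} on k+1 vertices, and let H be the disjoint union of H' and S. Then there exists a polynomial f such that χ(G) ≤ f(ω(G)) for every finite H-free graph G. -/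
open SimpleGraph

namespace StarPolyChi

open Finset

section Core

open scoped Classical

variable {V : Type} (G : SimpleGraph V)

/-- The subgraph of `G` induced on `A` can be properly coloured with `n` colours. -/
def FinColorable (A : Finset V) (n : ℕ) : Prop :=
  ∃ c : V → ℕ, (∀ v ∈ A, c v < n) ∧ ∀ u ∈ A, ∀ v ∈ A, G.Adj u v → c u ≠ c v

/-- Every clique of `G` inside `A` has at most `n` vertices. -/
def CliqueBound (A : Finset V) (n : ℕ) : Prop :=
  ∀ K ⊆ A, G.IsClique (K : Set V) → #K ≤ n

/-- No stable set of `G` inside `A` has exactly `n` vertices. -/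
def StableFree (A : Finset V) (n : ℕ) : Prop :=
  ∀ T ⊆ A, G.IsIndepSet (T : Set V) → #T ≠ n

/-- `c` and `T` are the centre and the set of leaves of an induced star with `k` leaves. -/
def IsStar (k : ℕ) (c : V) (T : Finset V) : Prop :=
  G.IsIndepSet (T : Set V) ∧ #T = k ∧ ∀ t ∈ T, G.Adj c t

/-- The neighbours of `v` inside `A`. -/
noncomputable def nbrs (A : Finset V) (v : V) : Finset V := A.filter (fun u => G.Adj v u)

/-- The members of `A` not adjacent to `v`, possibly including `v` itself. -/
noncomputable def nonNbrs (A : Finset V) (v : V) : Finset V := A.filter (fun u => ¬ G.Adj v u)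

variable {G}

lemma mem_nbrs {A : Finset V} {u v : V} : u ∈ nbrs G A v ↔ u ∈ A ∧ G.Adj v u := by
  simp [nbrs]

lemma mem_nonNbrs {A : Finset V} {u v : V} : u ∈ nonNbrs G A v ↔ u ∈ A ∧ ¬ G.Adj v u := by
  simp [nonNbrs]

lemma nbrs_subset (A : Finset V) (v : V) : nbrs G A v ⊆ A := filter_subset _ _

lemma nonNbrs_subset (A : Finset V) (v : V) : nonNbrs G A v ⊆ A := filter_subset _ _

lemma FinColorable.mono {A B : Finset V} {m n : ℕ} (h : FinColorable G B n) (hA : A ⊆ B)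
    (hn : n ≤ m) : FinColorable G A m := by
  obtain ⟨c, h1, h2⟩ := h
  exact ⟨c, fun v hv => (h1 v (hA hv)).trans_le hn, fun u hu v hv => h2 u (hA hu) v (hA hv)⟩

lemma FinColorable.union {A B : Finset V} {a b : ℕ} (hA : FinColorable G A a)
    (hB : FinColorable G B b) : FinColorable G (A ∪ B) (a + b) := by
  obtain ⟨c, h1, h2⟩ := hA
  obtain ⟨d, h3, h4⟩ := hB
  refine ⟨fun v => if v ∈ A then c v else a + d v, fun v hv => ?_, fun u hu v hv huv => ?_⟩
  · by_cases hvA : v ∈ A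
    · have := h1 v hvA
      simp only [hvA, if_true]
      omega
    · have := h3 v ((mem_union.1 hv).resolve_left hvA)
      simp only [hvA, if_false]
      omega
  · by_cases huA : u ∈ A <;> by_cases hvA : v ∈ A <;> simp only [huA, hvA, if_true, if_false]
    · exact h2 u huA v hvA huv
    · have := h1 u huA
      omega
    · have := h1 v hvA
      omega
    · have := h4 u ((mem_union.1 hu).resolve_left huA) v ((mem_union.1 hv).resolve_left hvA) huv
      omega

lemma finColorable_empty (n : ℕ) : FinColorable G ∅ n := ⟨fun _ => 0, by simp, by simp⟩

lemma finColorable_biUnion {ι : Type*} (I : Finset ι) (F : ι → Finset V) (a : ℕ)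
    (h : ∀ i ∈ I, FinColorable G (F i) a) : FinColorable G (I.biUnion F) (#I * a) := by
  induction I using Finset.induction_on with
  | empty => exact finColorable_empty _
  | insert i I hi ih =>
    rw [biUnion_insert, card_insert_of_notMem hi]
    exact ((h i (mem_insert_self _ _)).union
      (ih fun j hj => h j (mem_insert_of_mem hj))).mono subset_rfl (by ring_nf; omega)

lemma finColorable_singleton (v : V) : FinColorable G {v} 1 :=
  ⟨fun _ => 0, by simp, by simp⟩

lemma finColorable_card (A : Finset V) : FinColorable G A #A := by
  have := finColorable_biUnion (G := G) A (fun v => {v}) 1 fun v _ => finColorable_singleton v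
  simpa using this

lemma finColorable_of_degree_le {A : Finset V} {d : ℕ} (h : ∀ v ∈ A, #(nbrs G A v) ≤ d) :
    FinColorable G A (d + 1) := by
  induction A using Finset.induction_on with
  | empty => exact finColorable_empty _
  | insert a A ha ih =>
    obtain ⟨c, h1, h2⟩ := ih fun v hv => (card_le_card
      (filter_subset_filter _ (subset_insert _ _))).trans (h v (mem_insert_of_mem hv))
    obtain ⟨x, hx, hx'⟩ : ∃ x ∈ range (d + 1), x ∉ (nbrs G (insert a A) a).image c := by
      apply exists_mem_notMem_of_card_lt_card
      rw [card_range]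
      exact Nat.lt_succ_of_le (card_image_le.trans (h a (mem_insert_self _ _)))
    have hne : ∀ v ∈ A, G.Adj a v → x ≠ c v := fun v hv hav hxv =>
      hx' (mem_image.2 ⟨v, mem_nbrs.2 ⟨mem_insert_of_mem hv, hav⟩, hxv.symm⟩)
    have hA : ∀ v ∈ A, v ≠ a := fun v hv hva => ha (hva ▸ hv)
    refine ⟨fun v => if v = a then x else c v, fun v hv => ?_, fun u hu v hv huv => ?_⟩
    · rcases mem_insert.1 hv with rfl | hv
      · simpa using hx
      · simpa [hA v hv] using h1 v hv
    · rcases mem_insert.1 hu with rfl | hu' <;> rcases mem_insert.1 hv with rfl | hv'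
      · exact (G.loopless.irrefl _ huv).elim
      · simpa [hA v hv'] using hne v hv' huv
      · simpa [hA u hu'] using (hne u hu' huv.symm).symm
      · simpa [hA u hu', hA v hv'] using h2 u hu' v hv' huv

lemma CliqueBound.mono {A B : Finset V} {n : ℕ} (h : CliqueBound G B n) (hA : A ⊆ B) :
    CliqueBound G A n := fun K hK => h K (hK.trans hA)

lemma CliqueBound.nbrs {A : Finset V} {n : ℕ} (h : CliqueBound G A (n + 1)) {v : V} (hv : v ∈ A) :
    CliqueBound G (nbrs G A v) n := by
  intro K hK hKc
  have hvK : v ∉ K := fun hvK => G.loopless.irrefl _ (mem_nbrs.1 (hK hvK)).2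
  have := h (insert v K) (insert_subset hv (hK.trans (nbrs_subset _ _))) (by
    rw [coe_insert]
    exact hKc.insert fun b hb _ => (mem_nbrs.1 (hK hb)).2)
  rw [card_insert_of_notMem hvK] at this
  omega

lemma CliqueBound.of_common_nbr {A B : Finset V} {n : ℕ} (h : CliqueBound G A (n + 1)) (hB : B ⊆ A)
    (hcommon : ∀ K ⊆ B, #K = n + 1 → ∃ x ∈ A, ∀ v ∈ K, G.Adj v x) : CliqueBound G B n := by
  intro K hK hKc
  by_contra! hlt
  have hcard : #K = n + 1 := le_antisymm (h K (hK.trans hB) hKc) hlt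
  obtain ⟨x, hx, hxK⟩ := hcommon K hK hcard
  have := h.nbrs hx K (fun v hv => mem_nbrs.2 ⟨hB (hK hv), (hxK v hv).symm⟩) hKc
  omega

lemma finColorable_of_nonNbrs {n : ℕ} {A : Finset V} {m : ℕ} (hA : CliqueBound G A n)
    (h : ∀ v ∈ A, FinColorable G (nonNbrs G A v) m) : FinColorable G A (n * m) := by
  induction n generalizing A with
  | zero =>
    have : A = ∅ := by
      refine eq_empty_of_forall_notMem fun v hv => ?_
      have := hA {v} (singleton_subset_iff.2 hv) (by simp)
      simp at this
    rw [this]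
    exact finColorable_empty _
  | succ n ih =>
    rcases A.eq_empty_or_nonempty with rfl | ⟨v, hv⟩
    · exact finColorable_empty _
    have h1 := ih (hA.nbrs hv) fun u hu => (h u (nbrs_subset _ _ hu)).mono
      (filter_subset_filter _ (nbrs_subset _ _)) le_rfl
    refine (h1.union (h v hv)).mono (fun u hu => ?_) (by rw [add_mul, one_mul])
    by_cases huv : G.Adj v u
    · exact mem_union_left _ (mem_nbrs.2 ⟨hu, huv⟩)
    · exact mem_union_right _ (mem_nonNbrs.2 ⟨hu, huv⟩)

lemma StableFree.mono {A B : Finset V} {n : ℕ} (h : StableFree G B n) (hA : A ⊆ B) :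
    StableFree G A n := fun T hT => h T (hT.trans hA)

lemma IsIndepSet.subset {S T : Finset V} (h : G.IsIndepSet (T : Set V)) (hS : S ⊆ T) :
    G.IsIndepSet (S : Set V) :=
  Set.Pairwise.mono (coe_subset.2 hS) h

/-- Ramsey's theorem, with a bound polynomial in the clique number. -/
lemma card_le_of_stableFree {w k : ℕ} {A : Finset V} (hA : CliqueBound G A w)
    (h : StableFree G A k) : #A ≤ (w + 1) ^ (k + 1) := by
  induction k generalizing A with
  | zero => exact (h ∅ (empty_subset _) (by simp [IsIndepSet]) rfl).elim
  | succ k ih =>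
    obtain ⟨K, hK, hmax⟩ := exists_max_image (A.powerset.filter fun K : Finset V => G.IsClique (K : Set V))
      card ⟨∅, by simp⟩
    simp only [mem_filter, mem_powerset] at hK hmax
    have hcover : A ⊆ K.biUnion fun u => nonNbrs G A u := by
      intro v hv
      by_contra hcon
      have hadj : ∀ u ∈ K, G.Adj u v := by
        intro u hu
        by_contra huv
        exact hcon (mem_biUnion.2 ⟨u, hu, mem_nonNbrs.2 ⟨hv, huv⟩⟩)
      have hvK : v ∉ K := fun hvK => G.loopless.irrefl _ (hadj v hvK)
      have := hmax (insert v K) ⟨insert_subset hv hK.1, by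
        rw [coe_insert]
        exact hK.2.insert fun b hb _ => (hadj b hb).symm⟩
      rw [card_insert_of_notMem hvK] at this
      omega
    have hM : ∀ u ∈ K, #(nonNbrs G A u) ≤ (w + 1) ^ (k + 1) + 1 := by
      intro u hu
      have hsub : (nonNbrs G A u).erase u ⊆ A := (erase_subset _ _).trans (nonNbrs_subset _ _)
      have := ih (hA.mono hsub) fun T hT hTi hTk => by
        have huT : u ∉ T := fun huT => notMem_erase _ _ (hT huT)
        refine h (insert u T) (insert_subset (hK.1 hu) (hT.trans hsub)) ?_
          (by rw [card_insert_of_notMem huT, hTk])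
        have hadj : ∀ v ∈ T, ¬ G.Adj u v := fun v hv =>
          (mem_nonNbrs.1 (mem_of_mem_erase (hT hv))).2
        rw [coe_insert]
        exact Set.Pairwise.insert hTi fun b hb _ => ⟨hadj b hb, fun hb' => hadj b hb hb'.symm⟩
      have := pred_card_le_card_erase (s := nonNbrs G A u) (a := u)
      omega
    calc #A ≤ #(K.biUnion fun u => nonNbrs G A u) := card_le_card hcover
      _ ≤ #K * ((w + 1) ^ (k + 1) + 1) := card_biUnion_le_card_mul _ _ _ hM
      _ ≤ w * ((w + 1) ^ (k + 1) + 1) := Nat.mul_le_mul_right _ (hA K hK.1 hK.2)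
      _ ≤ (w + 1) ^ (k + 1 + 1) := by
        have : w + 1 ≤ (w + 1) ^ (k + 1) := Nat.le_self_pow (by omega) _
        rw [pow_succ (w + 1) (k + 1)]
        nlinarith

lemma FinColorable.card_le_of_stableFree {A : Finset V} {n s : ℕ} (hA : FinColorable G A n)
    (h : StableFree G A s) : #A ≤ n * s := by
  by_contra! hlt
  obtain ⟨c, h1, h2⟩ := hA
  obtain ⟨y, -, hy⟩ := exists_lt_card_fiber_of_mul_lt_card_of_maps_to (s := A) (t := range n)
    (f := c) (n := s) (fun a ha => mem_range.2 (h1 a ha)) (by simpa using hlt)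
  obtain ⟨T, hT, hTs⟩ := exists_subset_card_eq hy.le
  refine h T (hT.trans (filter_subset _ _)) (fun u hu v hv _ huv => ?_) hTs
  have hu' := mem_filter.1 (hT hu)
  have hv' := mem_filter.1 (hT hv)
  exact h2 u hu'.1 v hv'.1 huv (hu'.2.trans hv'.2.symm)

/-- If no induced star with `k` leaves lies in `A`, then `A` has small chromatic number. -/
lemma finColorable_of_no_star {A : Finset V} {w k : ℕ} (hA : CliqueBound G A w)
    (h : ∀ c ∈ A, ∀ T ⊆ A, ¬ IsStar G k c T) : FinColorable G A ((w + 1) ^ (k + 1) + 1) :=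
  finColorable_of_degree_le fun v hv => card_le_of_stableFree (hA.mono (nbrs_subset _ _))
    fun T hT hTi hTk => h v hv T (hT.trans (nbrs_subset _ _))
      ⟨hTi, hTk, fun _ ht => (mem_nbrs.1 (hT ht)).2⟩

variable (G) in
/-- The members of `U` that have no neighbour in some induced star contained in `X`. -/
noncomputable def missing (k : ℕ) (U X : Finset V) : Finset V :=
  U.filter fun v => ∃ c ∈ X, ∃ T ⊆ X, IsStar G k c T ∧ ¬ G.Adj v c ∧ ∀ t ∈ T, ¬ G.Adj v t

/-- Every induced star with `k` leaves dominates `U` up to a set that is `m`-colourable. -/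
def StarsDominate (G : SimpleGraph V) (k : ℕ) (U : Finset V) (m : ℕ) : Prop :=
  ∀ c T, IsStar G k c T →
    FinColorable G (U.filter fun v => ¬ G.Adj v c ∧ ∀ t ∈ T, ¬ G.Adj v t) m

lemma StarsDominate.mono {k m : ℕ} {U W : Finset V} (h : StarsDominate G k W m) (hU : U ⊆ W) :
    StarsDominate G k U m :=
  fun c T hcT => (h c T hcT).mono (filter_subset_filter _ hU) le_rfl

lemma StarsDominate.finColorable_missing {k m : ℕ} {U X : Finset V} {x : ℕ}
    (h : StarsDominate G k U m) (hX : #X ≤ x) :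
    FinColorable G (missing G k U X) (x ^ (k + 1) * m) := by
  have h1 := finColorable_biUnion (G := G)
    ((X ×ˢ X.powersetCard k).filter fun p => IsStar G k p.1 p.2)
    (fun p => U.filter fun v => ¬ G.Adj v p.1 ∧ ∀ t ∈ p.2, ¬ G.Adj v t) m
    (fun p hp => h p.1 p.2 (mem_filter.1 hp).2)
  refine h1.mono (fun v hv => ?_) (Nat.mul_le_mul_right _ ?_)
  · obtain ⟨hvU, c, hc, T, hT, hcT, h2, h3⟩ := mem_filter.1 hv
    exact mem_biUnion.2 ⟨(c, T), mem_filter.2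
      ⟨mem_product.2 ⟨hc, mem_powersetCard.2 ⟨hT, hcT.2.1⟩⟩, hcT⟩, mem_filter.2 ⟨hvU, h2, h3⟩⟩
  · calc _ ≤ #(X ×ˢ X.powersetCard k) := card_filter_le _ _
      _ = #X * (#X).choose k := by rw [card_product, card_powersetCard]
      _ ≤ x * x ^ k := Nat.mul_le_mul hX
          ((Nat.choose_le_pow _ _).trans (Nat.pow_le_pow_left hX _))
      _ = x ^ (k + 1) := by rw [pow_succ, mul_comm]

lemma card_nonNbrs_lt {k : ℕ} {U X T : Finset V} {c v : V}
    (hv : v ∈ U \ missing G k U X) (hc : c ∈ X) (hvc : ¬ G.Adj v c) (hTX : T ⊆ X)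
    (hT : G.IsIndepSet (T : Set V)) (hcT : ∀ t ∈ T, G.Adj c t) : #(nonNbrs G T v) < k := by
  by_contra! hle
  obtain ⟨S, hS, hSk⟩ := exists_subset_card_eq hle
  have hST : S ⊆ T := hS.trans (nonNbrs_subset _ _)
  rw [mem_sdiff] at hv
  exact hv.2 (mem_filter.2 ⟨hv.1, c, hc, S, hST.trans hTX,
    ⟨IsIndepSet.subset hT hST, hSk, fun t ht => hcT t (hST ht)⟩, hvc,
    fun t ht => (mem_nonNbrs.1 (hS ht)).2⟩)

/-- If members of `C` have fewer than `k` nonneighbours in `L`, then many members of `L` are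
adjacent to all of `C`. -/
lemma exists_complete_subset {k s : ℕ} {C L : Finset V} (h : ∀ v ∈ C, #(nonNbrs G L v) < k)
    (hL : #C * k + s ≤ #L) : ∃ S ⊆ L, #S = s ∧ ∀ v ∈ C, ∀ x ∈ S, G.Adj v x := by
  have h1 : #(C.biUnion fun v => nonNbrs G L v) ≤ #C * k :=
    card_biUnion_le_card_mul _ _ _ fun v hv => (h v hv).le
  have h2 := le_card_sdiff (C.biUnion fun v => nonNbrs G L v) L
  obtain ⟨S, hS, hSs⟩ := exists_subset_card_eq
    (n := s) (s := L \ C.biUnion fun v => nonNbrs G L v) (by omega)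
  refine ⟨S, hS.trans sdiff_subset, hSs, fun v hv x hx => ?_⟩
  by_contra hvx
  have hx' := mem_sdiff.1 (hS hx)
  exact hx'.2 (mem_biUnion.2 ⟨v, hv, mem_nonNbrs.2 ⟨hx'.1, hvx⟩⟩)

/-- There is no induced complete bipartite graph with both sides of size `s` inside `D`. -/
def BicliqueFree (G : SimpleGraph V) (D : Finset V) (s : ℕ) : Prop :=
  ∀ P ⊆ D, ∀ Q ⊆ D, G.IsIndepSet (P : Set V) → G.IsIndepSet (Q : Set V) → #P = s → #Q = s →
    ¬ ∀ p ∈ P, ∀ q ∈ Q, G.Adj p q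

lemma finColorable_of_bicliqueFree {k m s w n : ℕ} {D : Finset V} (hw : CliqueBound G D w)
    (hD : StarsDominate G k D m) (hfree : BicliqueFree G D s)
    (hn : ∀ Y ⊆ D, StableFree G Y s → #Y ≤ n * s)
    (hn' : ∀ Y ⊆ D, StableFree G Y ((k + 1) * s) → #Y ≤ n * ((k + 1) * s)) :
    FinColorable G D
      ((n * ((k + 1) * s) + 1) + w * (((k + 1) * s + 1) ^ (k + 1) * m + n * s)) := by
  set D₁ := D.filter fun v => StableFree G (nbrs G D v) ((k + 1) * s) with hD₁
  have h1 : FinColorable G D₁ (n * ((k + 1) * s) + 1) := by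
    refine finColorable_of_degree_le fun v hv => ?_
    exact (card_le_card (filter_subset_filter _ (filter_subset _ _))).trans
      (hn' _ (nbrs_subset _ _) (mem_filter.1 hv).2)
  have h2 : FinColorable G (D \ D₁) (w * (((k + 1) * s + 1) ^ (k + 1) * m + n * s)) := by
    refine finColorable_of_nonNbrs (hw.mono sdiff_subset) fun v hv => ?_
    have hvD : v ∈ D := (mem_sdiff.1 hv).1
    have hL : ¬ StableFree G (nbrs G D v) ((k + 1) * s) := fun hst =>
      (mem_sdiff.1 hv).2 (mem_filter.2 ⟨hvD, hst⟩)
    simp only [StableFree, not_forall, not_not] at hL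
    obtain ⟨L, hL, hLi, hLs⟩ := hL
    set X := insert v L
    have hX : #X ≤ (k + 1) * s + 1 := (card_insert_le _ _).trans (by rw [hLs])
    set Y := nonNbrs G D v \ missing G k D X with hY
    have hYD : Y ⊆ D := sdiff_subset.trans (nonNbrs_subset _ _)
    have hYs : StableFree G Y s := by
      intro C hC hCi hCs
      obtain ⟨S, hS, hSs, hCS⟩ := exists_complete_subset (G := G) (k := k) (s := s) (C := C)
        (L := L) (fun y hy => by
          have hy' := mem_sdiff.1 (hC hy)
          have hyv := mem_nonNbrs.1 hy'.1
          exact card_nonNbrs_lt (mem_sdiff.2 ⟨hyv.1, hy'.2⟩) (mem_insert_self v L)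
            (fun h => hyv.2 h.symm) (subset_insert _ _) hLi
            fun t ht => (mem_nbrs.1 (hL ht)).2) (by rw [hCs, hLs]; ring_nf; rfl)
      exact hfree C (hC.trans hYD) S (hS.trans (hL.trans (nbrs_subset _ _))) hCi
        (IsIndepSet.subset hLi hS) hCs hSs hCS
    have hYc : FinColorable G Y (n * s) := (finColorable_card Y).mono subset_rfl (hn Y hYD hYs)
    refine ((hD.finColorable_missing hX).union hYc).mono (fun u hu => ?_) le_rfl
    have hu' := mem_nonNbrs.1 hu
    by_cases hum : u ∈ missing G k D X
    · exact mem_union_left _ hum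
    · exact mem_union_right _ (mem_sdiff.2
        ⟨mem_nonNbrs.2 ⟨(mem_sdiff.1 hu'.1).1, hu'.2⟩, hum⟩)
  refine (h1.union h2).mono (fun u hu => ?_) le_rfl
  rw [union_sdiff_of_subset (filter_subset _ _)]
  exact hu

/-- The members of `𝒜` are stable sets of size `s` inside `U`, pairwise complete to each other. -/
structure IsTemplate (G : SimpleGraph V) (U : Finset V) (s : ℕ) (𝒜 : Finset (Finset V)) :
    Prop where
  subset : ∀ A ∈ 𝒜, A ⊆ U
  indep : ∀ A ∈ 𝒜, G.IsIndepSet (A : Set V)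
  card : ∀ A ∈ 𝒜, #A = s
  complete : ∀ A ∈ 𝒜, ∀ B ∈ 𝒜, A ≠ B → ∀ a ∈ A, ∀ b ∈ B, G.Adj a b

lemma IsTemplate.card_le {U : Finset V} {s w : ℕ} {𝒜 : Finset (Finset V)}
    (h : IsTemplate G U s 𝒜) (hs : 0 < s) (hw : CliqueBound G U w) : #𝒜 ≤ w := by
  have hne : ∀ A ∈ 𝒜, A.Nonempty := fun A hA => card_pos.1 (by rw [h.card A hA]; exact hs)
  rcases 𝒜.eq_empty_or_nonempty with rfl | ⟨A₀, hA₀⟩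
  · simp
  have : Nonempty V := (hne A₀ hA₀).to_type
  choose! r hr using hne
  have hadj : ∀ A ∈ 𝒜, ∀ B ∈ 𝒜, A ≠ B → G.Adj (r A) (r B) := fun A hA B hB hAB =>
    h.complete A hA B hB hAB _ (hr A hA) _ (hr B hB)
  have hinj : Set.InjOn r 𝒜 := by
    intro A hA B hB hAB
    by_contra hne
    exact (hadj A hA B hB hne).ne hAB
  rw [← card_image_of_injOn hinj]
  refine hw _ (image_subset_iff.2 fun A hA => h.subset A hA (hr A hA)) ?_
  intro x hx y hy hxy
  obtain ⟨A, hA, rfl⟩ := mem_image.1 hx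
  obtain ⟨B, hB, rfl⟩ := mem_image.1 hy
  exact hadj A hA B hB fun h => hxy (by rw [h])

variable (G) in
/-- The members of `U` adjacent to everything in members of `𝒜` other than `A`. -/
noncomputable def attached (U : Finset V) (𝒜 : Finset (Finset V)) (A : Finset V) : Finset V :=
  U.filter fun v => ∀ B ∈ 𝒜, B ≠ A → ∀ b ∈ B, G.Adj v b

lemma IsTemplate.bicliqueFree_attached {U : Finset V} {s : ℕ} {𝒜 : Finset (Finset V)}
    (h : IsTemplate G U s 𝒜) (hs : 0 < s) (hmax : ∀ ℬ, IsTemplate G U s ℬ → #ℬ ≤ #𝒜)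
    {A : Finset V} (hA : A ∈ 𝒜) : BicliqueFree G (attached G U 𝒜 A) s := by
  intro P hP Q hQ hPi hQi hPs hQs hPQ
  have hadj : ∀ R ⊆ attached G U 𝒜 A, ∀ B ∈ 𝒜.erase A, ∀ r ∈ R, ∀ b ∈ B, G.Adj r b :=
    fun R hR B hB r hr b hb =>
      (mem_filter.1 (hR hr)).2 B (mem_of_mem_erase hB) (ne_of_mem_erase hB) b hb
  have hnotMem : ∀ R ⊆ attached G U 𝒜 A, #R = s → R ∉ 𝒜.erase A := by
    intro R hR hRs hmem
    obtain ⟨r, hr⟩ := card_pos.1 (hRs.symm ▸ hs)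
    exact G.loopless.irrefl _ (hadj R hR R hmem r hr r hr)
  have hPQne : P ≠ Q := by
    rintro rfl
    obtain ⟨r, hr⟩ := card_pos.1 (hPs.symm ▸ hs)
    exact G.loopless.irrefl _ (hPQ r hr r hr)
  have hcard : #(insert P (insert Q (𝒜.erase A))) = #𝒜 + 1 := by
    rw [card_insert_of_notMem, card_insert_of_notMem (hnotMem Q hQ hQs),
      card_erase_add_one hA]
    simp only [mem_insert, not_or]
    exact ⟨hPQne, hnotMem P hP hPs⟩
  have hU : attached G U 𝒜 A ⊆ U := filter_subset _ _
  have := hmax (insert P (insert Q (𝒜.erase A))) (by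
    constructor
    · intro B hB
      rcases mem_insert.1 hB with rfl | hB
      · exact hP.trans hU
      rcases mem_insert.1 hB with rfl | hB
      · exact hQ.trans hU
      exact h.subset B (mem_of_mem_erase hB)
    · intro B hB
      rcases mem_insert.1 hB with rfl | hB
      · exact hPi
      rcases mem_insert.1 hB with rfl | hB
      · exact hQi
      exact h.indep B (mem_of_mem_erase hB)
    · intro B hB
      rcases mem_insert.1 hB with rfl | hB
      · exact hPs
      rcases mem_insert.1 hB with rfl | hB
      · exact hQs
      exact h.card B (mem_of_mem_erase hB)
    · intro B hB C hC hBC b hb c hc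
      rcases mem_insert.1 hB with rfl | hB₁
      · rcases mem_insert.1 hC with rfl | hC₁
        · exact (hBC rfl).elim
        rcases mem_insert.1 hC₁ with rfl | hC₂
        · exact hPQ b hb c hc
        exact hadj _ hP C hC₂ b hb c hc
      rcases mem_insert.1 hC with rfl | hC₁
      · rcases mem_insert.1 hB₁ with rfl | hB₂
        · exact (hPQ c hc b hb).symm
        exact (hadj _ hP B hB₂ c hc b hb).symm
      rcases mem_insert.1 hB₁ with rfl | hB₂
      · rcases mem_insert.1 hC₁ with rfl | hC₂
        · exact (hBC rfl).elim
        exact hadj _ hQ C hC₂ b hb c hc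
      rcases mem_insert.1 hC₁ with rfl | hC₂
      · exact (hadj _ hQ B hB₂ c hc b hb).symm
      exact h.complete B (mem_of_mem_erase hB₂) C (mem_of_mem_erase hC₂) hBC b hb c hc)
  omega

/-- Some set of bounded size has large chromatic number: the vertices dominating all its stars
have smaller clique number. -/
lemma cliqueBound_of_not_finColorable {k w j : ℕ} {U X : Finset V} (hj : j + 1 ≤ w)
    (hU : CliqueBound G U (j + 1)) (hXU : X ⊆ U)
    (hX : ¬ FinColorable G X (w * ((w + 1) ^ (k + 1) + 1))) :
    CliqueBound G (U \ missing G k U X) j := by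
  refine hU.of_common_nbr sdiff_subset fun K hK hKj => ?_
  by_contra! hcon
  refine hX ((finColorable_biUnion (G := G) K (fun v => nonNbrs G X v)
    ((w + 1) ^ (k + 1) + 1) fun v hv => ?_).mono (fun x hx => ?_) ?_)
  · have hsub := nonNbrs_subset (G := G) X v
    refine finColorable_of_no_star (w := w)
      (fun K' hK' hc => ((hU.mono (hsub.trans hXU)) K' hK' hc).trans hj) fun c hc T hT hcT => ?_
    have hv' := mem_sdiff.1 (hK hv)
    exact hv'.2 (mem_filter.2 ⟨hv'.1, c, hsub hc, T, hT.trans hsub, hcT, (mem_nonNbrs.1 hc).2,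
      fun t ht => (mem_nonNbrs.1 (hT ht)).2⟩)
  · obtain ⟨v, hv, hvx⟩ := hcon x (hXU hx)
    exact mem_biUnion.2 ⟨v, hv, mem_nonNbrs.2 ⟨hx, hvx⟩⟩
  · exact Nat.mul_le_mul_right _ (by omega)

/-- The vertices that are attached to no part of a template and dominate all its stars have smaller
clique number. -/
lemma IsTemplate.cliqueBound {k w j s : ℕ} {U : Finset V} {𝒜 : Finset (Finset V)}
    (h : IsTemplate G U s 𝒜) (hne : 𝒜.Nonempty) (hj : j + 1 ≤ w) (hs : w * k + 1 ≤ s)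
    (hU : CliqueBound G U (j + 1)) :
    CliqueBound G ((U \ missing G k U (𝒜.biUnion id)) \ 𝒜.biUnion (attached G U 𝒜)) j := by
  refine hU.of_common_nbr (sdiff_subset.trans sdiff_subset) fun K hK hKj => ?_
  obtain ⟨A, hA⟩ := hne
  obtain ⟨S, hS, hSs, hKS⟩ := exists_complete_subset (G := G) (k := k) (s := 1) (C := K) (L := A)
    (fun v hv => by
      have hv' := mem_sdiff.1 (hK hv)
      have hvA : v ∉ attached G U 𝒜 A := fun hvA => hv'.2 (mem_biUnion.2 ⟨A, hA, hvA⟩)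
      have : ∃ B ∈ 𝒜, B ≠ A ∧ ∃ b ∈ B, ¬ G.Adj v b := by
        by_contra! hcon
        exact hvA (mem_filter.2 ⟨(mem_sdiff.1 hv'.1).1, hcon⟩)
      obtain ⟨B, hB, hBA, b, hb, hvb⟩ := this
      exact card_nonNbrs_lt hv'.1 (mem_biUnion.2 ⟨B, hB, hb⟩) hvb
        (fun a ha => mem_biUnion.2 ⟨A, hA, ha⟩) (h.indep A hA) (h.complete B hB A hA hBA b hb))
    (by
      rw [h.card A hA, hKj]
      exact (Nat.add_le_add_right (Nat.mul_le_mul_right _ hj) _).trans hs)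
  obtain ⟨x, hx⟩ := card_pos.1 (by omega : 0 < #S)
  exact ⟨x, h.subset A hA (hS hx), fun v hv => hKS v hv x hx⟩

/-- Bound on the chromatic number of bicliquefree sets in the induction. -/
def bicliqueBound (k w m n s : ℕ) : ℕ :=
  (n * ((k + 1) * s) + 1) + w * (((k + 1) * s + 1) ^ (k + 1) * m + n * s)

/-- Number of extra colours needed when the clique number increases by one. -/
def stepBound (k w m n s : ℕ) : ℕ :=
  w * bicliqueBound k w m n s + (w * s) ^ (k + 1) * m +
    (n * ((k + 1) * s) + 1) ^ (k + 1) * m + n * s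

lemma finColorable_step {k m w j n s : ℕ} {U : Finset V} (hj : j + 1 ≤ w)
    (hn : n = w * ((w + 1) ^ (k + 1) + 1)) (hs : s = w * k + 1)
    (hU : CliqueBound G U (j + 1)) (hdom : StarsDominate G k U m) {a : ℕ}
    (ih : ∀ W ⊆ U, CliqueBound G W j → FinColorable G W a) :
    FinColorable G U (a + stepBound k w m n s) := by
  have hs0 : 0 < s := by omega
  by_cases hX : ∃ X ⊆ U, #X ≤ n * ((k + 1) * s) + 1 ∧ ¬ FinColorable G X n
  · obtain ⟨X, hXU, hXq, hXn⟩ := hX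
    have h1 := ih _ sdiff_subset
      (cliqueBound_of_not_finColorable (k := k) hj hU hXU (hn ▸ hXn))
    refine (h1.union (hdom.finColorable_missing hXq)).mono (fun u hu => ?_)
      (by unfold stepBound; omega)
    rwa [sdiff_union_of_subset (show missing G k U X ⊆ U from filter_subset _ _)]
  push Not at hX
  have hram : ∀ r ≤ (k + 1) * s, ∀ Y ⊆ U, StableFree G Y r → #Y ≤ n * r := by
    intro r hr Y hYU hYr
    by_contra! hlt
    obtain ⟨X, hXY, hXc⟩ := exists_subset_card_eq (Nat.succ_le_of_lt hlt)
    have := (hX X (hXY.trans hYU) (by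
      rw [hXc]
      exact Nat.succ_le_succ (Nat.mul_le_mul_left _ hr))).card_le_of_stableFree (hYr.mono hXY)
    omega
  have hsk : s ≤ (k + 1) * s := Nat.le_mul_of_pos_left _ (by omega)
  obtain ⟨𝒜, h𝒜, hmax⟩ := exists_max_image (U.powerset.powerset.filter (IsTemplate G U s))
    card ⟨∅, by
      simp only [mem_filter, mem_powerset, empty_subset, true_and]
      exact ⟨by simp, by simp, by simp, by simp⟩⟩
  replace h𝒜 : IsTemplate G U s 𝒜 := (mem_filter.1 h𝒜).2
  replace hmax : ∀ ℬ, IsTemplate G U s ℬ → #ℬ ≤ #𝒜 := fun ℬ hℬ => hmax ℬ (mem_filter.2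
    ⟨mem_powerset.2 fun B hB => mem_powerset.2 (hℬ.subset B hB), hℬ⟩)
  rcases 𝒜.eq_empty_or_nonempty with rfl | hne
  · have hst : StableFree G U s := by
      intro T hT hTi hTs
      have := hmax {T} ⟨by simpa using hT, by simpa using hTi, by simpa using hTs, by simp⟩
      simp at this
    exact (finColorable_card U).mono subset_rfl
      ((hram s hsk U subset_rfl hst).trans (by unfold stepBound; omega))
  have hcard : #𝒜 ≤ w := (h𝒜.card_le hs0 hU).trans hj
  have h1 := ih _ (sdiff_subset.trans sdiff_subset) (h𝒜.cliqueBound hne hj hs.ge hU)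
  have h2 : FinColorable G (missing G k U (𝒜.biUnion id)) ((w * s) ^ (k + 1) * m) :=
    hdom.finColorable_missing ((card_biUnion_le_card_mul _ _ s
      fun A hA => (h𝒜.card A hA).le).trans (Nat.mul_le_mul_right _ hcard))
  have h3 : FinColorable G (𝒜.biUnion (attached G U 𝒜)) (w * bicliqueBound k w m n s) := by
    refine (finColorable_biUnion 𝒜 _ (bicliqueBound k w m n s) fun A hA => ?_).mono subset_rfl
      (Nat.mul_le_mul_right _ hcard)
    have hsub : attached G U 𝒜 A ⊆ U := filter_subset _ _
    exact finColorable_of_bicliqueFree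
      (fun K hK hKc => ((hU.mono hsub) K hK hKc).trans hj) (hdom.mono hsub)
      (h𝒜.bicliqueFree_attached hs0 hmax hA) (fun Y hY => hram s hsk Y (hY.trans hsub))
      (fun Y hY => hram _ le_rfl Y (hY.trans hsub))
  refine ((h1.union h2).union h3).mono (fun u hu => ?_) (by unfold stepBound; omega)
  simp only [mem_union, mem_sdiff]
  tauto

lemma finColorable_of_starsDominate {k m w j n s : ℕ} {U : Finset V} (hj : j ≤ w)
    (hn : n = w * ((w + 1) ^ (k + 1) + 1)) (hs : s = w * k + 1)
    (hU : CliqueBound G U j) (hdom : StarsDominate G k U m) :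
    FinColorable G U (j * stepBound k w m n s) := by
  induction j generalizing U with
  | zero =>
    have := finColorable_of_nonNbrs (m := #U) hU
      fun v _ => (finColorable_card U).mono (nonNbrs_subset _ _) le_rfl
    simpa using this
  | succ j ih =>
    rw [add_mul, one_mul]
    exact finColorable_step hj hn hs hU hdom
      fun W hW hWj => ih (by omega) hWj (hdom.mono hW)

lemma finColorable_univ_iff [Fintype V] {n : ℕ} :
    FinColorable G Finset.univ n ↔ G.Colorable n := by
  constructor
  · rintro ⟨c, h1, h2⟩
    exact ⟨Coloring.mk (fun v => ⟨c v, h1 v (mem_univ v)⟩) fun {u v} huv h =>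
      h2 u (mem_univ u) v (mem_univ v) huv (congrArg Fin.val h)⟩
  · rintro ⟨c⟩
    exact ⟨fun v => c v, fun v _ => (c v).2, fun u _ v _ huv h => c.valid huv (Fin.ext h)⟩

lemma finColorable_of_colorable_induce {A : Finset V} {n : ℕ}
    (h : (G.induce (A : Set V)).Colorable n) : FinColorable G A n := by
  obtain ⟨c⟩ := h
  refine ⟨fun v => if hv : v ∈ A then c ⟨v, hv⟩ else 0, fun v hv => ?_, fun u hu v hv huv => ?_⟩
  · simp [hv]
  · simp only [hu, hv, dif_pos]
    exact fun h => c.valid (v := ⟨u, hu⟩) (w := ⟨v, hv⟩) huv (Fin.ext h)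

/-- A copy of `H'` anticomplete to an induced star gives a copy of the disjoint union. -/
lemma induce_isInducedSubgraphFree {V' : Type} {H' : SimpleGraph V'} {k : ℕ} (hk : 1 ≤ k)
    (hG : IsInducedSubgraphFree (H' ⊕g completeBipartiteGraph (Fin 1) (Fin k)) G)
    {c : V} {T : Finset V} (hcT : IsStar G k c T) {A : Set V}
    (hA : ∀ v ∈ A, ¬ G.Adj v c ∧ ∀ t ∈ T, ¬ G.Adj v t) :
    IsInducedSubgraphFree H' (G.induce A) := by
  rintro ⟨s, ⟨e⟩⟩
  obtain ⟨hTi, hTk, hc⟩ := hcT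
  obtain ⟨t₀, ht₀⟩ := card_pos.1 (by omega : 0 < #T)
  let σ : Fin k ≃ T := (T.equivFinOfCardEq hTk).symm
  let φ : V' → V := fun x => (e x).1.1
  have hφA : ∀ x, φ x ∈ A := fun x => (e x).1.2
  have hφadj : ∀ x y, G.Adj (φ x) (φ y) ↔ H'.Adj x y := fun x y => e.map_rel_iff
  have hφinj : Function.Injective φ := fun x y h =>
    e.injective (Subtype.ext (Subtype.ext h))
  have hφc : ∀ x, φ x ≠ c := fun x h => (hA _ (hφA x)).2 t₀ ht₀ (h ▸ hc t₀ ht₀)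
  have hφT : ∀ x, ∀ i, φ x ≠ σ i := fun x i h =>
    (hA _ (hφA x)).1 (h ▸ (hc _ (σ i).2).symm)
  have hcσ : ∀ i, G.Adj c (σ i) := fun i => hc _ (σ i).2
  have hσ : ∀ i j, ¬ G.Adj (σ i) (σ j) := fun i j h => hTi (σ i).2 (σ j).2 h.ne h
  have hφc' : ∀ x, ¬ G.Adj (φ x) c := fun x => (hA _ (hφA x)).1
  have hφσ : ∀ x i, ¬ G.Adj (φ x) (σ i) := fun x i => (hA _ (hφA x)).2 _ (σ i).2
  let f : V' ⊕ (Fin 1 ⊕ Fin k) → V := Sum.elim φ (Sum.elim (fun _ => c) fun i => σ i)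
  have hf : Function.Injective f := by
    rintro (x | x | x) (y | y | y) h
    · exact congrArg Sum.inl (hφinj h)
    · exact (hφc x h).elim
    · exact (hφT x y h).elim
    · exact (hφc y h.symm).elim
    · rw [Subsingleton.elim x y]
    · exact ((hcσ y).ne h).elim
    · exact (hφT y x h.symm).elim
    · exact ((hcσ x).ne h.symm).elim
    · rw [σ.injective (Subtype.ext h)]
  let F : (H' ⊕g completeBipartiteGraph (Fin 1) (Fin k)) ↪g G :=
    { toFun := f
      inj' := hf
      map_rel_iff' := by
        rintro (x | x | x) (y | y | y)
        · exact hφadj x y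
        · exact iff_of_false (hφc' x) (by simp [SimpleGraph.sum])
        · exact iff_of_false (hφσ x y) (by simp [SimpleGraph.sum])
        · exact iff_of_false (fun h => hφc' y h.symm) (by simp [SimpleGraph.sum])
        · exact iff_of_false (G.loopless.irrefl c) (by simp)
        · exact iff_of_true (hcσ y) (by simp)
        · exact iff_of_false (fun h => hφσ y x h.symm) (by simp [SimpleGraph.sum])
        · exact iff_of_true (hcσ x).symm (by simp)
        · exact iff_of_false (hσ x y) (by simp) }
  exact hG ⟨Set.range F, ⟨F.isoInduceRange⟩⟩

lemma eval_mono (f : Polynomial ℕ) {a b : ℕ} (h : a ≤ b) : f.eval a ≤ f.eval b := by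
  rw [Polynomial.eval_eq_sum, Polynomial.eval_eq_sum]
  exact Finset.sum_le_sum fun i _ => Nat.mul_le_mul_left _ (Nat.pow_le_pow_left h i)

end Core

end StarPolyChi

open StarPolyChi in
theorem stmt_3 {V' : Type} [Fintype V'] (H' : SimpleGraph V')
    (hH' : ∃ f' : Polynomial ℕ, ∀ (V : Type) [Fintype V] (G : SimpleGraph V),
      IsInducedSubgraphFree H' G → G.chromaticNumber ≤ (f'.eval G.cliqueNum : ℕ))
    (k : ℕ) (hk : 1 ≤ k) :
    ∃ f : Polynomial ℕ, ∀ (V : Type) [Fintype V] (G : SimpleGraph V),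
      IsInducedSubgraphFree (H' ⊕g completeBipartiteGraph (Fin 1) (Fin k)) G →
      G.chromaticNumber ≤ (f.eval G.cliqueNum : ℕ) := by
  classical
  obtain ⟨f', hf'⟩ := hH'
  let n : Polynomial ℕ := .X * ((.X + 1) ^ (k + 1) + 1)
  let s : Polynomial ℕ := .X * .C k + 1
  let l : Polynomial ℕ := .C (k + 1) * s
  refine ⟨.X * (.X * ((n * l + 1) + .X * ((l + 1) ^ (k + 1) * f' + n * s)) +
    (.X * s) ^ (k + 1) * f' + (n * l + 1) ^ (k + 1) * f' + n * s), fun V _ G hG => ?_⟩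
  rw [chromaticNumber_le_iff_colorable, ← finColorable_univ_iff]
  have h := finColorable_of_starsDominate (G := G) (k := k) (m := f'.eval G.cliqueNum)
    (U := Finset.univ) (le_refl G.cliqueNum) rfl rfl
    (fun K _ hK => IsClique.card_le_cliqueNum (tc := hK)) (fun c T hcT => by
      apply finColorable_of_colorable_induce
      rw [← chromaticNumber_le_iff_colorable]
      refine (hf' _ _ (induce_isInducedSubgraphFree hk hG hcT fun v hv => ?_)).trans
        (Nat.cast_le.2 (eval_mono f' (cliqueNum_induce_le _)))
      simpa using hv)
  refine h.mono subset_rfl (le_of_eq ?_)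
  simp only [stepBound, bicliqueBound, n, s, l, Polynomial.eval_mul, Polynomial.eval_add,
    Polynomial.eval_pow, Polynomial.eval_X, Polynomial.eval_one, Polynomial.eval_C]
end
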